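/- arXiv:1203.2742 — 10 statements merged into one kernel-verified Lean document; each statement's English description precedes it below -/
import Mathlib

section
/- Let V be a filled sparsity pattern on {1,…,n}. If j ∈ I_k for some vertex k, then j is a proper ancestor of k in the elimination tree of V (i.e., j is obtained from k by iterating the parent map at least once, each iterate having a well-defined parent). -/
/-- A sparsity pattern on `{1,…,n}`: a set of pairs `(i,j)` with `n ≥ i > j ≥ 1`. -/
def IsPattern (n : ℕ) (V : Finset (ℕ × ℕ)) : Prop :=
  ∀ p ∈ V, 1 ≤ p.2 ∧ p.2 < p.1 ∧ p.1 ≤ n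

/-- A pattern is filled (chordal) if `i > j > k`, `(i,k) ∈ V`, `(j,k) ∈ V` imply `(i,j) ∈ V`. -/
def IsFilled (V : Finset (ℕ × ℕ)) : Prop :=
  ∀ i j k : ℕ, k < j → j < i → (i, k) ∈ V → (j, k) ∈ V → (i, j) ∈ V

/-- `I_k = {i : i > k, (i,k) ∈ V}`. -/
def lowerNbrs (V : Finset (ℕ × ℕ)) (k : ℕ) : Finset ℕ :=
  (V.filter (fun p => p.2 = k ∧ k < p.1)).image Prod.fst

/-- `I⁺_k = {k} ∪ I_k`. -/
def lowerNbrsPlus (V : Finset (ℕ × ℕ)) (k : ℕ) : Finset ℕ :=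
  insert k (lowerNbrs V k)

/-- `j` is the parent of `k` in the elimination tree: `I_k ≠ ∅` and `j = min I_k`. -/
def ParentOf (V : Finset (ℕ × ℕ)) (j k : ℕ) : Prop :=
  j ∈ lowerNbrs V k ∧ ∀ i ∈ lowerNbrs V k, j ≤ i

/-- `j` is an ancestor of `k`: `j` is obtained from `k` by iterating the parent map
zero or more times. -/
def EtreeAncestor (V : Finset (ℕ × ℕ)) (j k : ℕ) : Prop :=
  Relation.ReflTransGen (fun a b => ParentOf V b a) k j

/-- `j` is a proper ancestor of `k`: obtained by iterating the parent map at least once. -/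
def EtreeProperAncestor (V : Finset (ℕ × ℕ)) (j k : ℕ) : Prop :=
  Relation.TransGen (fun a b => ParentOf V b a) k j

/-- A set `W` of vertices is complete for `V`: all pairs in `W` are joined in `V`. -/
def IsCompleteSet (V : Finset (ℕ × ℕ)) (W : Finset ℕ) : Prop :=
  ∀ i ∈ W, ∀ j ∈ W, j < i → (i, j) ∈ V

/-- A clique: a complete subset of `{1,…,n}` maximal with respect to inclusion. -/
def IsCliqueOf (n : ℕ) (V : Finset (ℕ × ℕ)) (W : Finset ℕ) : Prop :=
  W ⊆ Finset.Icc 1 n ∧ IsCompleteSet V W ∧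
    ∀ W' ⊆ Finset.Icc 1 n, IsCompleteSet V W' → W ⊆ W' → W = W'

theorem mem_lowerNbrs_aux (V : Finset (ℕ × ℕ)) (k i : ℕ) :
    i ∈ lowerNbrs V k ↔ (i, k) ∈ V ∧ k < i := by
  unfold lowerNbrs
  simp only [Finset.mem_image, Finset.mem_filter]
  constructor
  · rintro ⟨⟨a, b⟩, ⟨h1, h2, h3⟩, h4⟩
    simp only at h2 h3 h4
    subst h2 h4
    exact ⟨h1, h3⟩
  · rintro ⟨h1, h2⟩
    exact ⟨(i, k), ⟨h1, rfl, h2⟩, rfl⟩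

theorem properAncestor_aux (V : Finset (ℕ × ℕ)) (hF : IsFilled V) (j : ℕ) :
    ∀ d k : ℕ, j - k ≤ d → j ∈ lowerNbrs V k → EtreeProperAncestor V j k := by
  intro d
  induction d with
  | zero =>
    intro k hd hj
    have := ((mem_lowerNbrs_aux V k j).1 hj).2
    omega
  | succ d ih =>
    intro k hd hj
    have hne : (lowerNbrs V k).Nonempty := ⟨j, hj⟩
    have hp : ParentOf V ((lowerNbrs V k).min' hne) k :=
      ⟨Finset.min'_mem _ hne, fun i hi => Finset.min'_le _ i hi⟩
    generalize (lowerNbrs V k).min' hne = p at hp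
    obtain ⟨hjV, hkj⟩ := (mem_lowerNbrs_aux V k j).1 hj
    obtain ⟨hpV, hkp⟩ := (mem_lowerNbrs_aux V k p).1 hp.1
    rcases (hp.2 j hj).eq_or_lt with h | h
    · subst h
      exact Relation.TransGen.single hp
    · exact Relation.TransGen.head hp (ih p (by omega)
        ((mem_lowerNbrs_aux V p j).2 ⟨hF j p k hkp h hjV hpV, h⟩))

/-- If `j ∈ I_k`, then `j` is a proper ancestor of `k` in the elimination tree. -/
theorem stmt_0 (n : ℕ) (hn : 1 ≤ n) (V : Finset (ℕ × ℕ))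
    (hV : IsPattern n V) (hF : IsFilled V) (k j : ℕ)
    (hj : j ∈ lowerNbrs V k) :
    EtreeProperAncestor V j k := by
  exact properAncestor_aux V hF j (j - k) k le_rfl hj
end

section
/- Let V be a filled sparsity pattern on {1,…,n}. Every clique W of V satisfies W = I⁺_{min W}. Consequently the map sending a clique to its least element is injective, so V has at most n cliques. -/
/-- Every clique `W` of a filled pattern satisfies `W = I⁺_{min W}`; consequently the map
sending a clique to its least element is injective, and there are at most `n` cliques. -/
theorem stmt_6 (n : ℕ) (hn : 1 ≤ n) (V : Finset (ℕ × ℕ))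
    (hV : IsPattern n V) (hF : IsFilled V) :
    (∀ W : Finset ℕ, IsCliqueOf n V W →
      ∃ hW : W.Nonempty, W = lowerNbrsPlus V (W.min' hW)) ∧
    Set.InjOn (fun W : Finset ℕ => W.min) {W | IsCliqueOf n V W} ∧
    {W : Finset ℕ | IsCliqueOf n V W}.ncard ≤ n := by
  have mem : ∀ k i, i ∈ lowerNbrsPlus V k ↔ i = k ∨ (k < i ∧ (i, k) ∈ V) := by
    intro k i
    simp only [lowerNbrsPlus, lowerNbrs, Finset.mem_insert, Finset.mem_image, Finset.mem_filter]
    constructor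
    · rintro (h | ⟨⟨a, b⟩, ⟨h1, h2, h3⟩, h4⟩)
      · exact Or.inl h
      · simp only at h2 h3 h4
        subst h2 h4
        exact Or.inr ⟨h3, h1⟩
    · rintro (h | ⟨h1, h2⟩)
      · exact Or.inl h
      · exact Or.inr ⟨(i, k), ⟨h2, rfl, h1⟩, rfl⟩
  have key : ∀ W : Finset ℕ, IsCliqueOf n V W →
      ∃ hW : W.Nonempty, W = lowerNbrsPlus V (W.min' hW) := by
    rintro W ⟨hs, hc, hm⟩
    have hW : W.Nonempty := by
      rw [Finset.nonempty_iff_ne_empty]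
      rintro rfl
      have h := hm {1} (by simpa using hn)
        (by intro i hi j hj hij; simp at hi hj; omega) (by simp)
      exact absurd h.symm (Finset.singleton_ne_empty 1)
    refine ⟨hW, ?_⟩
    have hk := Finset.min'_mem W hW
    have hle : ∀ i ∈ W, W.min' hW ≤ i := fun i hi => Finset.min'_le W i hi
    generalize W.min' hW = k at hk hle
    apply hm
    · intro i hi
      rcases (mem k i).1 hi with rfl | ⟨h1, h2⟩
      · exact hs hk
      · have := hV _ h2
        simp only at this
        rw [Finset.mem_Icc]
        omega
    · intro i hi j hj hij
      rcases (mem k i).1 hi with rfl | ⟨h1, h2⟩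
      · rcases (mem _ j).1 hj with rfl | ⟨h3, h4⟩ <;> omega
      · rcases (mem _ j).1 hj with rfl | ⟨h3, h4⟩
        · exact h2
        · exact hF i j k h3 hij h2 h4
    · intro i hi
      rw [mem]
      rcases (hle i hi).eq_or_lt with h | h
      · exact Or.inl h.symm
      · exact Or.inr ⟨h, hc i hi k hk h⟩
  have inj : Set.InjOn (fun W : Finset ℕ => W.min) {W | IsCliqueOf n V W} := by
    intro A hA B hB hAB
    obtain ⟨ha, hA'⟩ := key A hA
    obtain ⟨hb, hB'⟩ := key B hB
    have h : A.min = B.min := hAB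
    rw [← Finset.coe_min' ha, ← Finset.coe_min' hb] at h
    have h' : A.min' ha = B.min' hb := WithTop.coe_injective h
    rw [hA', hB', h']
  refine ⟨key, inj, ?_⟩
  have hcard : ((Finset.Icc 1 n).image (fun k : ℕ => (k : WithTop ℕ))).card ≤ n :=
    Finset.card_image_le.trans (by simp)
  refine le_trans ?_ hcard
  rw [← Set.ncard_coe_finset]
  refine Set.ncard_le_ncard_of_injOn _ ?_ inj (Finset.finite_toSet _)
  intro W hW
  obtain ⟨hne, -⟩ := key W hW
  rw [Finset.mem_coe, Finset.mem_image]
  exact ⟨W.min' hne, hW.1 (Finset.min'_mem W hne), Finset.coe_min' hne⟩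
end

section
/- Let V be a filled sparsity pattern on {1,…,n} and let i ∈ {1,…,n}. Then I⁺_i is a clique of V if and only if there exists no j < i with I⁺_i ⊊ I⁺_j. -/
theorem mem_lnp (V : Finset (ℕ × ℕ)) (k x : ℕ) :
    x ∈ lowerNbrsPlus V k ↔ x = k ∨ (k < x ∧ (x, k) ∈ V) := by
  simp only [lowerNbrsPlus, lowerNbrs, Finset.mem_insert, Finset.mem_image, Finset.mem_filter,
    Prod.exists]
  grind

theorem lnp_complete (V : Finset (ℕ × ℕ)) (hF : IsFilled V) (k : ℕ) :
    IsCompleteSet V (lowerNbrsPlus V k) := by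
  intro a ha b hb hab
  rw [mem_lnp] at ha hb
  rcases ha with rfl | ⟨h1, h2⟩ <;> rcases hb with rfl | ⟨h3, h4⟩
  · omega
  · omega
  · exact h2
  · exact hF a b k h3 hab h2 h4

theorem lnp_subset (n : ℕ) (V : Finset (ℕ × ℕ)) (hV : IsPattern n V) (k : ℕ)
    (h1 : 1 ≤ k) (h2 : k ≤ n) : lowerNbrsPlus V k ⊆ Finset.Icc 1 n := by
  intro x hx
  rw [mem_lnp] at hx
  rw [Finset.mem_Icc]
  rcases hx with rfl | ⟨h3, h4⟩
  · exact ⟨h1, h2⟩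
  · exact ⟨by omega, (hV _ h4).2.2⟩

/-- `I⁺_i` is a clique if and only if there is no vertex `j < i` with `I⁺_i ⊊ I⁺_j`. -/
theorem stmt_7 (n : ℕ) (hn : 1 ≤ n) (V : Finset (ℕ × ℕ))
    (hV : IsPattern n V) (hF : IsFilled V) (i : ℕ) (hi : i ∈ Finset.Icc 1 n) :
    IsCliqueOf n V (lowerNbrsPlus V i) ↔
      ¬ ∃ j, 1 ≤ j ∧ j < i ∧ lowerNbrsPlus V i ⊂ lowerNbrsPlus V j := by
  rw [Finset.mem_Icc] at hi
  constructor
  · rintro ⟨-, -, hmax⟩ ⟨j, hj1, hji, hss⟩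
    exact hss.ne (hmax _ (lnp_subset n V hV j hj1 (by omega)) (lnp_complete V hF j) hss.subset)
  · intro hno
    refine ⟨lnp_subset n V hV i hi.1 hi.2, lnp_complete V hF i, ?_⟩
    intro W hW hWc hsub
    refine Finset.Subset.antisymm hsub ?_
    intro x hx
    by_contra hxn
    have hiW : i ∈ W := hsub ((mem_lnp V i i).2 (Or.inl rfl))
    have hxi : x < i := by
      by_contra hge
      apply hxn
      rw [mem_lnp]
      rcases Nat.eq_or_lt_of_le (not_lt.mp hge) with h | h
      · exact Or.inl h.symm
      · exact Or.inr ⟨h, hWc x hx i hiW h⟩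
    refine hno ⟨x, (Finset.mem_Icc.mp (hW hx)).1, hxi, ?_⟩
    rw [Finset.ssubset_iff_of_subset]
    · exact ⟨x, (mem_lnp V x x).2 (Or.inl rfl), hxn⟩
    · intro y hy
      have hyx : x < y := by
        rcases (mem_lnp V i y).1 hy with h | h <;> omega
      exact (mem_lnp V x y).2 (Or.inr ⟨hyx, hWc y (hsub hy) x hx hyx⟩)
end

section
/- Let V be a filled sparsity pattern on {1,…,n} with elimination tree as defined. A vertex j satisfies that I⁺_j is a clique of V if and only if |I_j| > |I_k| − 1 for every child k of j in the elimination tree. -/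
theorem mem_lowerNbrs_iff {n : ℕ} {V : Finset (ℕ × ℕ)} (hV : IsPattern n V) (i k : ℕ) :
    i ∈ lowerNbrs V k ↔ (i, k) ∈ V := by
  unfold lowerNbrs
  simp only [Finset.mem_image, Finset.mem_filter, Prod.exists]
  constructor
  · rintro ⟨a, b, ⟨h1, h2, h3⟩, h4⟩
    subst h2 h4
    exact h1
  · intro h
    exact ⟨i, k, ⟨h, rfl, (hV _ h).2.1⟩, rfl⟩

theorem plus_complete {n : ℕ} {V : Finset (ℕ × ℕ)} (hV : IsPattern n V) (hF : IsFilled V)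
    (k : ℕ) : IsCompleteSet V (lowerNbrsPlus V k) := by
  intro a ha b hb hab
  simp only [lowerNbrsPlus, Finset.mem_insert, mem_lowerNbrs_iff hV] at ha hb
  rcases ha with rfl | ha
  · rcases hb with rfl | hb
    · omega
    · have := (hV _ hb).2.1
      simp only at this
      omega
  · rcases hb with rfl | hb
    · exact ha
    · exact hF a b k (hV _ hb).2.1 hab ha hb

theorem plus_subset {n : ℕ} {V : Finset (ℕ × ℕ)} (hV : IsPattern n V)
    (k : ℕ) (hk : k ∈ Finset.Icc 1 n) : lowerNbrsPlus V k ⊆ Finset.Icc 1 n := by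
  intro a ha
  simp only [lowerNbrsPlus, Finset.mem_insert, mem_lowerNbrs_iff hV] at ha
  rcases ha with rfl | ha
  · exact hk
  · have := hV _ ha
    simp only at this
    simp only [Finset.mem_Icc]
    omega

theorem nbrs_subset_parent {n : ℕ} {V : Finset (ℕ × ℕ)} (hV : IsPattern n V) (hF : IsFilled V)
    (j k : ℕ) (h : ParentOf V j k) : lowerNbrs V k ⊆ lowerNbrsPlus V j := by
  intro a ha
  have h1 := h.2 a ha
  have h2 := h.1
  simp only [lowerNbrsPlus, Finset.mem_insert, mem_lowerNbrs_iff hV] at ha h2 ⊢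
  rcases Nat.eq_or_lt_of_le h1 with h3 | h3
  · exact Or.inl h3.symm
  · exact Or.inr (hF a j k (hV _ h2).2.1 h3 ha h2)

theorem exists_child {n : ℕ} {V : Finset (ℕ × ℕ)} (hV : IsPattern n V) (hF : IsFilled V)
    (j : ℕ) : ∀ m w : ℕ, j - w ≤ m → lowerNbrsPlus V j ⊆ lowerNbrs V w →
      ∃ k, ParentOf V j k ∧ lowerNbrsPlus V j ⊆ lowerNbrs V k := by
  intro m
  induction m with
  | zero =>
    intro w hw hs
    have h1 := hs (Finset.mem_insert_self j _)
    rw [mem_lowerNbrs_iff hV] at h1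
    have := (hV _ h1).2.1
    simp only at this
    omega
  | succ m ih =>
    intro w hw hs
    have h1 := hs (Finset.mem_insert_self j _)
    have hne : (lowerNbrs V w).Nonempty := ⟨j, h1⟩
    have hp : ParentOf V ((lowerNbrs V w).min' hne) w :=
      ⟨Finset.min'_mem _ _, fun i hi => Finset.min'_le _ i hi⟩
    generalize (lowerNbrs V w).min' hne = p at hp
    have hpj := hp.2 j h1
    have hwp := hp.1
    rw [mem_lowerNbrs_iff hV] at hwp
    have hwp := (hV _ hwp).2.1
    simp only at hwp
    rcases Nat.eq_or_lt_of_le hpj with h3 | h3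
    · exact ⟨w, h3 ▸ hp, hs⟩
    · apply ih p (by omega)
      intro a ha
      have h4 := nbrs_subset_parent hV hF p w hp (hs ha)
      have h5 : j ≤ a := by
        simp only [lowerNbrsPlus, Finset.mem_insert, mem_lowerNbrs_iff hV] at ha
        rcases ha with rfl | ha
        · exact le_rfl
        · exact (hV _ ha).2.1.le
      rcases Finset.mem_insert.1 h4 with h6 | h6
      · omega
      · exact h6

theorem card_plus {n : ℕ} {V : Finset (ℕ × ℕ)} (hV : IsPattern n V) (j : ℕ) :
    (lowerNbrsPlus V j).card = (lowerNbrs V j).card + 1 := by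
  apply Finset.card_insert_of_notMem
  rw [mem_lowerNbrs_iff hV]
  intro h
  exact lt_irrefl _ (hV _ h).2.1

/-- `I⁺_j` is a clique if and only if `|I_j| > |I_k| − 1` for every child `k` of `j`
in the elimination tree. -/
theorem stmt_8 (n : ℕ) (hn : 1 ≤ n) (V : Finset (ℕ × ℕ))
    (hV : IsPattern n V) (hF : IsFilled V) (j : ℕ) (hj : j ∈ Finset.Icc 1 n) :
    IsCliqueOf n V (lowerNbrsPlus V j) ↔
      ∀ k, ParentOf V j k →
        ((lowerNbrs V k).card : ℤ) - 1 < ((lowerNbrs V j).card : ℤ) := by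
  constructor
  · rintro ⟨-, -, hmax⟩ k hk
    by_contra hc
    have hs := nbrs_subset_parent hV hF j k hk
    have hcard := card_plus hV j
    have heq : lowerNbrs V k = lowerNbrsPlus V j :=
      Finset.eq_of_subset_of_card_le hs (by omega)
    have hjk := hk.1
    rw [mem_lowerNbrs_iff hV] at hjk
    have hb := hV _ hjk
    simp only at hb
    have h1 := hmax (lowerNbrsPlus V k)
      (plus_subset hV k (by simp only [Finset.mem_Icc]; omega)) (plus_complete hV hF k)
      (by rw [← heq]; exact Finset.subset_insert _ _)
    have h2 : k ∈ lowerNbrs V k := by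
      rw [heq, h1]
      exact Finset.mem_insert_self _ _
    rw [mem_lowerNbrs_iff hV] at h2
    exact lt_irrefl _ (hV _ h2).2.1
  · intro h
    refine ⟨plus_subset hV j hj, plus_complete hV hF j, ?_⟩
    intro W hW hWc hs
    refine Finset.Subset.antisymm hs ?_
    intro w hw
    by_contra hwn
    have hjW : j ∈ W := hs (Finset.mem_insert_self j _)
    have hne : w ≠ j := fun e => hwn (Finset.mem_insert.2 (Or.inl e))
    have hlt : w < j := by
      by_contra hge
      apply hwn
      apply Finset.mem_insert_of_mem
      rw [mem_lowerNbrs_iff hV]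
      exact hWc w hw j hjW (by omega)
    have hsub : lowerNbrsPlus V j ⊆ lowerNbrs V w := by
      intro a ha
      rw [mem_lowerNbrs_iff hV]
      apply hWc a (hs ha) w hw
      simp only [lowerNbrsPlus, Finset.mem_insert, mem_lowerNbrs_iff hV] at ha
      rcases ha with rfl | ha
      · exact hlt
      · exact hlt.trans (hV _ ha).2.1
    obtain ⟨k, hk, hks⟩ := exists_child hV hF j _ w le_rfl hsub
    have h1 := h k hk
    have h2 := Finset.card_le_card hks
    rw [card_plus hV] at h2
    omega
end

section
/- Let V be a filled sparsity pattern on {1,…,n}. If j is the parent of k in the elimination tree of V and |I_k| = |I_j| + 1, then I_k = I⁺_j (and in particular I⁺_j ⊊ I⁺_k). -/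
/-- If `j` is the parent of `k` and `|I_k| = |I_j| + 1`, then `I_k = I⁺_j`,
and in particular `I⁺_j ⊊ I⁺_k`. -/
theorem stmt_9 (n : ℕ) (hn : 1 ≤ n) (V : Finset (ℕ × ℕ))
    (hV : IsPattern n V) (hF : IsFilled V) (j k : ℕ)
    (h : ParentOf V j k)
    (hcard : (lowerNbrs V k).card = (lowerNbrs V j).card + 1) :
    lowerNbrs V k = lowerNbrsPlus V j ∧
    lowerNbrsPlus V j ⊂ lowerNbrsPlus V k := by
  have hmem : ∀ a b, a ∈ lowerNbrs V b ↔ (a, b) ∈ V ∧ b < a := by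
    intro a b
    simp only [lowerNbrs, Finset.mem_image, Finset.mem_filter, Prod.exists]
    constructor
    · rintro ⟨x, y, ⟨hxy, rfl, hlt⟩, rfl⟩
      exact ⟨hxy, hlt⟩
    · rintro ⟨hab, hlt⟩
      exact ⟨a, b, ⟨hab, rfl, hlt⟩, rfl⟩
  obtain ⟨hj, hmin⟩ := h
  have hj2 := (hmem j k).1 hj
  have hsub : lowerNbrs V k ⊆ lowerNbrsPlus V j := by
    intro i hi
    have hi2 := (hmem i k).1 hi
    rcases (hmin i hi).eq_or_lt with rfl | hlt
    · exact Finset.mem_insert_self _ _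
    · exact Finset.mem_insert_of_mem
        ((hmem i j).2 ⟨hF i j k hj2.2 hlt hi2.1 hj2.1, hlt⟩)
  have heq : lowerNbrs V k = lowerNbrsPlus V j := by
    apply Finset.eq_of_subset_of_card_le hsub
    rw [hcard]
    exact Finset.card_insert_le _ _
  refine ⟨heq, ?_⟩
  rw [← heq]
  apply Finset.ssubset_insert
  intro hk
  exact lt_irrefl _ ((hmem k k).1 hk).2
end

section
/- Let V be a filled sparsity pattern on {1,…,n} and let X ∈ S^n_V be positive definite. Then there exist a unit lower-triangular real matrix L whose strictly lower-triangular nonzero entries are contained in V (i.e., L_{ij} ≠ 0 with i > j implies (i,j) ∈ V) and a diagonal matrix D with positive diagonal entries such that X = L D Lᵀ. -/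
open Matrix

/-- A sparsity pattern on `Fin n`: a set of pairs `(i,j)` with `i > j`. -/
def IsPatternF {n : ℕ} (V : Finset (Fin n × Fin n)) : Prop :=
  ∀ p ∈ V, p.2 < p.1

/-- A pattern is filled (chordal) if `i > j > k`, `(i,k) ∈ V`, `(j,k) ∈ V` imply `(i,j) ∈ V`. -/
def IsFilledF {n : ℕ} (V : Finset (Fin n × Fin n)) : Prop :=
  ∀ i j k : Fin n, k < j → j < i → (i, k) ∈ V → (j, k) ∈ V → (i, j) ∈ V

/-- `X ∈ S^n_V`: a real symmetric matrix whose off-diagonal entries outside `V` vanish. -/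
def InSV {n : ℕ} (V : Finset (Fin n × Fin n)) (X : Matrix (Fin n) (Fin n) ℝ) : Prop :=
  X.IsSymm ∧ ∀ i j, i ≠ j → (i, j) ∉ V → (j, i) ∉ V → X i j = 0

/-- The projection `P(A)` onto `S^n_V`. -/
def projV {n : ℕ} (V : Finset (Fin n × Fin n)) (A : Matrix (Fin n) (Fin n) ℝ) :
    Matrix (Fin n) (Fin n) ℝ :=
  Matrix.of fun i j => if i = j ∨ (i, j) ∈ V ∨ (j, i) ∈ V then A i j else 0

/-- A unit lower-triangular matrix. -/
def UnitLowerTri {n : ℕ} (L : Matrix (Fin n) (Fin n) ℝ) : Prop :=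
  (∀ i, L i i = 1) ∧ ∀ i j, i < j → L i j = 0

/-- The strictly lower-triangular nonzero entries of `L` are contained in `V`. -/
def StrictLowerSupportIn {n : ℕ} (V : Finset (Fin n × Fin n))
    (L : Matrix (Fin n) (Fin n) ℝ) : Prop :=
  ∀ i j : Fin n, j < i → L i j ≠ 0 → (i, j) ∈ V

/-- `I_k = {i : i > k, (i,k) ∈ V}`. -/
def lowerNbrsF {n : ℕ} (V : Finset (Fin n × Fin n)) (k : Fin n) : Finset (Fin n) :=
  Finset.univ.filter fun i => k < i ∧ (i, k) ∈ V

theorem ldl_aux (n : ℕ) : ∀ (P : Fin n → Fin n → Prop)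
    (_ : ∀ i j k : Fin n, k < j → j < i → P i k → P j k → P i j)
    (X : Fin n → Fin n → ℝ) (_ : ∀ i j, X i j = X j i)
    (_ : ∀ i j, j < i → X i j ≠ 0 → P i j)
    (_ : ∀ x : Fin n → ℝ, x ≠ 0 → 0 < ∑ i, ∑ j, x i * X i j * x j),
    ∃ (L : Fin n → Fin n → ℝ) (d : Fin n → ℝ), (∀ i, L i i = 1) ∧ (∀ i j, i < j → L i j = 0) ∧
      (∀ i j, j < i → L i j ≠ 0 → P i j) ∧ (∀ i, 0 < d i) ∧
      ∀ i j, X i j = ∑ k, L i k * d k * L j k := by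
  induction n with
  | zero =>
    intro P _ X _ _ _
    exact ⟨fun i => i.elim0, fun i => i.elim0, fun i => i.elim0, fun i => i.elim0,
      fun i => i.elim0, fun i => i.elim0, fun i => i.elim0⟩
  | succ n ih =>
    intro P hP X hs hX hpd
    have ha : 0 < X 0 0 := by
      have h := hpd (Fin.cons 1 (fun _ => 0)) (fun h => by simpa using congrFun h 0)
      simpa [Fin.sum_univ_succ] using h
    have hane := ha.ne'
    obtain ⟨L, d, h1, h2, h3, h4, h5⟩ := ih (fun i j => P i.succ j.succ)
      (fun i j k hkj hji => hP i.succ j.succ k.succ (by simpa using hkj) (by simpa using hji))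
      (fun i j => X i.succ j.succ - X i.succ 0 * X j.succ 0 / X 0 0)
      (fun i j => by rw [hs i.succ j.succ]; ring)
      (fun i j hji h => by
        by_contra hn
        have e1 : X i.succ j.succ = 0 := by
          by_contra h0
          exact hn (hX _ _ (by simpa using hji) h0)
        have e2 : X i.succ 0 ≠ 0 := by
          intro h0
          simp [e1, h0] at h
        have e3 : X j.succ 0 ≠ 0 := by
          intro h0
          simp [e1, h0] at h
        exact hn (hP _ _ 0 (Fin.succ_pos _) (by simpa using hji)
          (hX _ _ (Fin.succ_pos _) e2) (hX _ _ (Fin.succ_pos _) e3)))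
      (fun x hx => by
        have h := hpd (Fin.cons (-(∑ i, x i * X i.succ 0) / X 0 0) x) (fun h => hx (by
          funext i
          simpa using congrFun h i.succ))
        simp only [Fin.sum_univ_succ, Fin.cons_zero, Fin.cons_succ, Finset.sum_add_distrib] at h
        have e1 : ∀ t : ℝ, ∑ j : Fin n, t * X 0 j.succ * x j = t * ∑ i, x i * X i.succ 0 := by
          intro t
          rw [Finset.mul_sum]
          refine Finset.sum_congr rfl fun j _ => ?_
          rw [hs 0 j.succ]; ring
        rw [e1, ← Finset.sum_mul] at h
        have e2 : ∑ i, ∑ j, x i * (X i.succ j.succ - X i.succ 0 * X j.succ 0 / X 0 0) * x j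
            = (∑ i, ∑ j, x i * X i.succ j.succ * x j)
              - (∑ i, x i * X i.succ 0) * (∑ i, x i * X i.succ 0) / X 0 0 := by
          rw [Finset.sum_mul_sum, Finset.sum_div, ← Finset.sum_sub_distrib]
          refine Finset.sum_congr rfl fun i _ => ?_
          rw [Finset.sum_div, ← Finset.sum_sub_distrib]
          refine Finset.sum_congr rfl fun j _ => ?_
          ring
        rw [e2]
        convert h using 1
        field_simp
        ring)
    refine ⟨Fin.cons (Fin.cons 1 (fun _ => 0)) (fun i => Fin.cons (X i.succ 0 / X 0 0) (L i)),
      Fin.cons (X 0 0) d, ?_, ?_, ?_, ?_, ?_⟩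
    · intro i
      refine Fin.cases ?_ (fun i => ?_) i <;> simp [h1]
    · intro i j
      refine Fin.cases ?_ (fun i => ?_) i <;> refine Fin.cases ?_ (fun j => ?_) j <;> simp
      exact h2 i j
    · intro i j
      refine Fin.cases ?_ (fun i => ?_) i <;> refine Fin.cases ?_ (fun j => ?_) j
      · simp
      · simp
      · intro h h'
        refine hX _ _ h fun h0 => ?_
        simp [h0] at h'
      · intro h h'
        exact h3 i j (by simpa using h) (by simpa using h')
    · intro i
      refine Fin.cases ?_ (fun i => ?_) i <;> simp [h4, ha]
    · intro i j
      refine Fin.cases ?_ (fun i => ?_) i <;> refine Fin.cases ?_ (fun j => ?_) j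
      · simp [Fin.sum_univ_succ]
      · simp [Fin.sum_univ_succ]
        rw [hs 0 j.succ]; field_simp
      · simp [Fin.sum_univ_succ]
        field_simp
      · have := h5 i j
        simp only [Fin.sum_univ_succ, Fin.cons_zero, Fin.cons_succ]
        rw [← this]
        field_simp
        ring

/-- A positive definite matrix with filled sparsity pattern `V` has a Cholesky
factorization `X = L D Lᵀ` with `L` unit lower triangular, the strictly
lower-triangular nonzeros of `L` contained in `V`, and `D` diagonal with
positive diagonal entries. -/
theorem stmt_12 (n : ℕ) (hn : 1 ≤ n) (V : Finset (Fin n × Fin n))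
    (hV : IsPatternF V) (hF : IsFilledF V)
    (X : Matrix (Fin n) (Fin n) ℝ) (hX : InSV V X) (hXpd : X.PosDef) :
    ∃ (L : Matrix (Fin n) (Fin n) ℝ) (d : Fin n → ℝ),
      UnitLowerTri L ∧ StrictLowerSupportIn V L ∧ (∀ i, 0 < d i) ∧
      X = L * Matrix.diagonal d * Lᵀ := by
  obtain ⟨L, d, h1, h2, h3, h4, h5⟩ := ldl_aux n (fun i j => (i, j) ∈ V) hF X
    (fun i j => hX.1.apply j i)
    (fun i j hji h => by
      by_contra hn
      exact h (hX.2 i j hji.ne' hn fun h' => absurd (hV _ h') (not_lt.mpr hji.le)))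
    (fun x hx => by
      have h := hXpd.dotProduct_mulVec_pos hx
      simpa [dotProduct, mulVec, Finset.mul_sum, mul_assoc] using h)
  refine ⟨Matrix.of L, d, ⟨h1, h2⟩, h3, h4, ?_⟩
  ext i j
  rw [h5 i j, Matrix.mul_apply]
  simp [Matrix.mul_diagonal]
end

section
/- Let V be a sparsity pattern on {1,…,n}, let L be a unit lower-triangular real matrix whose strictly lower-triangular nonzero entries are contained in V, let D be diagonal with positive diagonal entries, and let X = L D Lᵀ and Z = X⁻¹. Then for every j ∈ {1,…,n}: (a) Z_{ij} = −∑_{k ∈ I_j} Z_{ik} L_{kj} for every i ∈ I_j, and (b) Z_{jj} = 1/D_{jj} − ∑_{k ∈ I_j} Z_{jk} L_{kj}. In particular, when V is filled, the projected inverse S = P(X⁻¹) satisfies S_{I_j j} = −S_{I_j I_j} L_{I_j j} and S_{jj} = 1/D_{jj} − S_{I_j j}ᵀ L_{I_j j}, so S can be computed using only entries of X⁻¹ in positions of V. -/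
open Matrix

/-- Column identity `(Z L)_{ij} = Z_{ij} + ∑_{k ∈ I_j} Z_{ik} L_{kj}`. -/
theorem mul_apply_lowerNbrs {n : ℕ} (V : Finset (Fin n × Fin n))
    (L : Matrix (Fin n) (Fin n) ℝ) (hL : UnitLowerTri L)
    (hLV : StrictLowerSupportIn V L) (Z : Matrix (Fin n) (Fin n) ℝ) (i j : Fin n) :
    (Z * L) i j = Z i j + ∑ k ∈ lowerNbrsF V j, Z i k * L k j := by
  have hj : j ∉ lowerNbrsF V j := by simp [lowerNbrsF]
  have h1 : Z i j + ∑ k ∈ lowerNbrsF V j, Z i k * L k j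
      = ∑ k ∈ insert j (lowerNbrsF V j), Z i k * L k j := by
    rw [Finset.sum_insert hj, hL.1 j, mul_one]
  rw [h1, Matrix.mul_apply]
  symm
  apply Finset.sum_subset (Finset.subset_univ _)
  intro k _ hk
  rw [Finset.mem_insert, not_or] at hk
  have h0 : L k j = 0 := by
    rcases lt_or_gt_of_ne hk.1 with h | h
    · exact hL.2 k j h
    · by_contra hne
      exact hk.2 (by simp [lowerNbrsF, h, hLV k j h hne])
  rw [h0, mul_zero]

/-- `Z L` is upper triangular with diagonal `1 / d`. -/
theorem inv_mul_lower {n : ℕ}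
    (L : Matrix (Fin n) (Fin n) ℝ) (hL : UnitLowerTri L)
    (d : Fin n → ℝ) (hd : ∀ i, 0 < d i) :
    (∀ i j, j < i → ((L * Matrix.diagonal d * Lᵀ)⁻¹ * L) i j = 0) ∧
      ∀ j, ((L * Matrix.diagonal d * Lᵀ)⁻¹ * L) j j = 1 / d j := by
  have hdet : L.det = 1 := by
    rw [Matrix.det_of_lowerTriangular L (fun i j h => hL.2 i j h)]
    simp [hL.1]
  have hLu : IsUnit L.det := by simp [hdet]
  have hLtu : IsUnit (Lᵀ).det := by simp [hdet]
  have hDu : IsUnit (Matrix.diagonal d).det := by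
    rw [Matrix.det_diagonal, isUnit_iff_ne_zero]
    exact Finset.prod_ne_zero_iff.2 fun i _ => (hd i).ne'
  have hW : ∀ i j, j < i → (Lᵀ)⁻¹ i j = 0 := by
    letI : Invertible Lᵀ := Matrix.invertibleOfIsUnitDet _ hLtu
    have hbt : Matrix.BlockTriangular (Lᵀ) id := fun i j h => hL.2 j i h
    exact fun i j h => Matrix.blockTriangular_inv_of_blockTriangular hbt h
  have hWd : ∀ j, (Lᵀ)⁻¹ j j = 1 := by
    intro j
    have h := congrFun (congrFun (Matrix.nonsing_inv_mul _ hLtu) j) j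
    rw [Matrix.mul_apply, Finset.sum_eq_single j, Matrix.one_apply_eq] at h
    · simpa [hL.1] using h
    · intro k _ hk
      rcases lt_or_gt_of_ne hk with hk | hk
      · rw [hW j k hk, zero_mul]
      · rw [Matrix.transpose_apply, hL.2 j k hk, mul_zero]
    · simp
  have hDinv : (Matrix.diagonal d)⁻¹ = Matrix.diagonal fun i => 1 / d i := by
    apply Matrix.inv_eq_right_inv
    rw [Matrix.diagonal_mul_diagonal, ← Matrix.diagonal_one]
    congr 1
    funext i
    exact mul_one_div_cancel (hd i).ne'
  have hZL : (L * Matrix.diagonal d * Lᵀ)⁻¹ * L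
      = (Lᵀ)⁻¹ * Matrix.diagonal fun i => 1 / d i := by
    rw [Matrix.mul_inv_rev, Matrix.mul_inv_rev, hDinv, Matrix.mul_assoc, Matrix.mul_assoc,
      Matrix.nonsing_inv_mul _ hLu, Matrix.mul_one]
  rw [hZL]
  constructor
  · intro i j h
    rw [Matrix.mul_diagonal, hW i j h, zero_mul]
  · intro j
    rw [Matrix.mul_diagonal, hWd j, one_mul]

/-- For `X = L D Lᵀ` with `L` unit lower triangular supported in `V` and `D` positive
diagonal, the inverse `Z = X⁻¹` satisfies, for every `j`:
(a) `Z_{ij} = −∑_{k ∈ I_j} Z_{ik} L_{kj}` for `i ∈ I_j`, and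
(b) `Z_{jj} = 1/D_{jj} − ∑_{k ∈ I_j} Z_{jk} L_{kj}`;
so the projected inverse `P(X⁻¹)` is determined by entries of `X⁻¹` in positions of `V`. -/
theorem stmt_13 (n : ℕ) (hn : 1 ≤ n) (V : Finset (Fin n × Fin n))
    (hV : IsPatternF V)
    (L : Matrix (Fin n) (Fin n) ℝ) (hL : UnitLowerTri L)
    (hLV : StrictLowerSupportIn V L)
    (d : Fin n → ℝ) (hd : ∀ i, 0 < d i)
    (X Z : Matrix (Fin n) (Fin n) ℝ)
    (hX : X = L * Matrix.diagonal d * Lᵀ) (hZ : Z = X⁻¹) :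
    ∀ j : Fin n,
      (∀ i ∈ lowerNbrsF V j, Z i j = -∑ k ∈ lowerNbrsF V j, Z i k * L k j) ∧
      Z j j = 1 / d j - ∑ k ∈ lowerNbrsF V j, Z j k * L k j := by
  subst hZ hX
  obtain ⟨h0, h1⟩ := inv_mul_lower L hL d hd
  intro j
  refine ⟨fun i hi => ?_, ?_⟩
  · have hji : j < i := (Finset.mem_filter.1 hi).2.1
    have h := h0 i j hji
    rw [mul_apply_lowerNbrs V L hL hLV] at h
    linarith
  · have h := h1 j
    rw [mul_apply_lowerNbrs V L hL hLV] at h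
    linarith

/-- The filled case: the recursion for the projected inverse `S = P(X⁻¹)`. -/
theorem projected_inverse_recursion (n : ℕ) (hn : 1 ≤ n) (V : Finset (Fin n × Fin n))
    (hV : IsPatternF V) (hF : IsFilledF V)
    (L : Matrix (Fin n) (Fin n) ℝ) (hL : UnitLowerTri L)
    (hLV : StrictLowerSupportIn V L)
    (d : Fin n → ℝ) (hd : ∀ i, 0 < d i)
    (X S : Matrix (Fin n) (Fin n) ℝ)
    (hX : X = L * Matrix.diagonal d * Lᵀ) (hS : S = projV V X⁻¹) :
    ∀ j : Fin n,
      (∀ i ∈ lowerNbrsF V j, S i j = -∑ k ∈ lowerNbrsF V j, S i k * L k j) ∧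
      S j j = 1 / d j - ∑ k ∈ lowerNbrsF V j, S k j * L k j := by
  intro j
  obtain ⟨ha, hb⟩ := stmt_13 n hn V hV L hL hLV d hd X X⁻¹ hX rfl j
  have hsymm : ∀ i k, X⁻¹ i k = X⁻¹ k i := by
    have hXs : Xᵀ = X := by
      rw [hX]; simp [Matrix.mul_assoc]
    intro i k
    conv_lhs => rw [← hXs, ← Matrix.transpose_nonsing_inv, Matrix.transpose_apply]
  have hmem : ∀ i ∈ lowerNbrsF V j, (i, j) ∈ V ∧ j < i := fun i hi =>
    ⟨(Finset.mem_filter.1 hi).2.2, (Finset.mem_filter.1 hi).2.1⟩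
  have hcol : ∀ i ∈ lowerNbrsF V j, S i j = X⁻¹ i j := by
    intro i hi
    simp [hS, projV, (hmem i hi).1]
  have hblk : ∀ i ∈ lowerNbrsF V j, ∀ k ∈ lowerNbrsF V j, S i k = X⁻¹ i k := by
    intro i hi k hk
    have hc : i = k ∨ (i, k) ∈ V ∨ (k, i) ∈ V := by
      rcases lt_trichotomy i k with h | h | h
      · exact Or.inr (Or.inr (hF k i j (hmem i hi).2 h (hmem k hk).1 (hmem i hi).1))
      · exact Or.inl h
      · exact Or.inr (Or.inl (hF i k j (hmem k hk).2 h (hmem i hi).1 (hmem k hk).1))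
    simp only [hS, projV, Matrix.of_apply, if_pos hc]
  refine ⟨fun i hi => ?_, ?_⟩
  · rw [hcol i hi, ha i hi]
    congr 1
    exact Finset.sum_congr rfl fun k hk => by rw [hblk i hi k hk]
  · have hjj : S j j = X⁻¹ j j := by simp [hS, projV]
    rw [hjj, hb]
    congr 1
    exact Finset.sum_congr rfl fun k hk => by rw [hcol k hk, hsymm j k]
end

section
/- Let V be a sparsity pattern on {1,…,n} and let Z be a real symmetric positive definite n×n matrix such that Z⁻¹ ∈ S^n_V. Then Z is the maximum-determinant positive definite completion of P(Z): for every real symmetric positive definite matrix Z' with P(Z') = P(Z), one has det Z' ≤ det Z, with equality if and only if Z' = Z. -/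
theorem aux_det {n : ℕ} (M : Matrix (Fin n) (Fin n) ℝ) (hM : M.PosDef) (ht : M.trace = n) :
    M.det ≤ 1 ∧ (M.det = 1 → M = 1) := by
  have hd : M.det = ∏ i, hM.1.eigenvalues i := by
    simpa using hM.1.det_eq_prod_eigenvalues
  have hs : ∑ i, hM.1.eigenvalues i = n := by
    rw [← ht]; simpa using hM.1.trace_eq_sum_eigenvalues.symm
  have hp := hM.eigenvalues_pos
  have he : ∏ i, Real.exp (hM.1.eigenvalues i - 1) = 1 := by
    rw [← Real.exp_sum, Finset.sum_sub_distrib, hs]; simp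
  have hle : ∀ i, hM.1.eigenvalues i ≤ Real.exp (hM.1.eigenvalues i - 1) := fun i => by
    have := Real.add_one_le_exp (hM.1.eigenvalues i - 1)
    linarith
  constructor
  · rw [hd, ← he]
    exact Finset.prod_le_prod (fun i _ => (hp i).le) (fun i _ => hle i)
  · intro h1
    have hall : ∀ i, hM.1.eigenvalues i = 1 := by
      by_contra hne
      push Not at hne
      obtain ⟨j, hj⟩ := hne
      have hlt : ∏ i, hM.1.eigenvalues i < ∏ i, Real.exp (hM.1.eigenvalues i - 1) := by
        refine Finset.prod_lt_prod (fun i _ => hp i) (fun i _ => hle i) ⟨j, Finset.mem_univ _, ?_⟩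
        have := Real.add_one_lt_exp (sub_ne_zero.mpr hj)
        linarith
      rw [he, ← hd, h1] at hlt
      exact lt_irrefl _ hlt
    have hsp := hM.1.spectral_theorem
    have hdiag : Matrix.diagonal (RCLike.ofReal ∘ hM.1.eigenvalues) = (1 : Matrix (Fin n) (Fin n) ℝ) := by
      rw [← Matrix.diagonal_one]
      congr 1
      funext i
      simp [hall]
    rw [hdiag, map_one] at hsp
    exact hsp

theorem aux_trace {n : ℕ} (V : Finset (Fin n × Fin n)) (Y A B : Matrix (Fin n) (Fin n) ℝ)
    (hY : InSV V Y) (hA : A.IsSymm) (hB : B.IsSymm) (h : projV V A = projV V B) :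
    (Y * A).trace = (Y * B).trace := by
  simp only [Matrix.trace, Matrix.diag, Matrix.mul_apply]
  refine Finset.sum_congr rfl fun i _ => Finset.sum_congr rfl fun j _ => ?_
  by_cases hc : j = i ∨ (j, i) ∈ V ∨ (i, j) ∈ V
  · have := congrFun (congrFun h j) i
    simp only [projV, Matrix.of_apply, if_pos hc] at this
    rw [this]
  · push Not at hc
    rw [hY.2 i j (Ne.symm hc.1) hc.2.2 hc.2.1]; simp

open scoped MatrixOrder in
theorem aux_factor {n : ℕ} (Y : Matrix (Fin n) (Fin n) ℝ) (hY : Y.PosDef) :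
    ∃ B : Matrix (Fin n) (Fin n) ℝ, Y = B.conjTranspose * B := by
  have h := hY.posSemidef.nonneg
  obtain ⟨B, hB⟩ := CStarAlgebra.nonneg_iff_eq_star_mul_self.mp h
  exact ⟨B, hB⟩

/-- If `Z` is symmetric positive definite with `Z⁻¹ ∈ S^n_V`, then `Z` is the maximum
determinant positive definite completion of `P(Z)`: every symmetric positive definite
`Z'` with `P(Z') = P(Z)` satisfies `det Z' ≤ det Z`, with equality iff `Z' = Z`. -/
theorem stmt_17 (n : ℕ) (hn : 1 ≤ n) (V : Finset (Fin n × Fin n))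
    (hV : IsPatternF V)
    (Z : Matrix (Fin n) (Fin n) ℝ) (hZsym : Z.IsSymm) (hZpd : Z.PosDef)
    (hZinv : InSV V Z⁻¹) :
    ∀ Z' : Matrix (Fin n) (Fin n) ℝ, Z'.IsSymm → Z'.PosDef →
      projV V Z' = projV V Z →
      Z'.det ≤ Z.det ∧ (Z'.det = Z.det ↔ Z' = Z) := by
  intro Z' hs' hpd' hP
  have hdZ := hZpd.det_pos
  have hu : IsUnit Z.det := hdZ.ne'.isUnit
  obtain ⟨B, hB⟩ := aux_factor Z⁻¹ hZpd.inv
  have hdB : B.det * B.det * Z.det = 1 := by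
    have h1 : (Z⁻¹ * Z).det = 1 := by rw [Matrix.nonsing_inv_mul _ hu, Matrix.det_one]
    rw [hB] at h1
    simpa [Matrix.det_mul, Matrix.det_conjTranspose] using h1
  have hB0 : B.det ≠ 0 := by
    intro h0; simp [h0] at hdB
  have hBu : IsUnit B := (Matrix.isUnit_iff_isUnit_det B).2 hB0.isUnit
  have hMpd : (B * Z' * B.conjTranspose).PosDef :=
    (Matrix.IsUnit.posDef_star_right_conjugate_iff hBu).2 hpd'
  have htr : (B * Z' * B.conjTranspose).trace = n := by
    rw [Matrix.trace_mul_comm, ← Matrix.mul_assoc, ← hB,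
      aux_trace V _ Z' Z hZinv hs' hZsym hP, Matrix.nonsing_inv_mul _ hu]
    simp
  have hdet : (B * Z' * B.conjTranspose).det * Z.det = Z'.det := by
    simp only [Matrix.det_mul, Matrix.det_conjTranspose, star_trivial]
    linear_combination Z'.det * hdB
  obtain ⟨hle, heq⟩ := aux_det _ hMpd htr
  refine ⟨?_, ?_, fun h => by rw [h]⟩
  · rw [← hdet]
    nlinarith
  · intro h
    have h1 : (B * Z' * B.conjTranspose).det = 1 := by
      rw [h] at hdet
      exact mul_right_cancel₀ hdZ.ne' (by linarith)
    have hM := heq h1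
    rw [Matrix.mul_assoc] at hM
    have h2 : Z' * B.conjTranspose * B = 1 := mul_eq_one_comm.mp hM
    rw [Matrix.mul_assoc, ← hB] at h2
    calc Z' = Z' * Z⁻¹ * Z := by
          rw [Matrix.mul_assoc, Matrix.nonsing_inv_mul _ hu, Matrix.mul_one]
      _ = Z := by rw [h2, Matrix.one_mul]
end

section
/- Let V be a sparsity pattern on {1,…,n}, let X̂ ∈ S^n_V be positive definite, and let S = P(X̂⁻¹). Then for every positive definite X ∈ S^n_V, −tr(S X) + log det X ≤ log det X̂ − n, with equality if and only if X = X̂. Consequently the conjugate barrier f_*(S) = sup{ −tr(S X) − f(X) : X ∈ S^n_V, X positive definite }, where f(X) = −log det X, is attained at X̂ and equals log det X̂ − n. -/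
open Matrix in
lemma log_det_le_trace {n : ℕ} (M : Matrix (Fin n) (Fin n) ℝ) (hM : M.PosDef) :
    Real.log M.det ≤ M.trace - n ∧ (Real.log M.det = M.trace - n → M = 1) := by
  have hp := hM.eigenvalues_pos
  have hd : Real.log M.det = ∑ i, Real.log (hM.isHermitian.eigenvalues i) := by
    rw [hM.isHermitian.det_eq_prod_eigenvalues]
    simp only [RCLike.ofReal_real_eq_id, id]
    exact Real.log_prod fun i _ => (hp i).ne'
  have ht : M.trace - n = ∑ i, (hM.isHermitian.eigenvalues i - 1) := by
    rw [hM.isHermitian.trace_eq_sum_eigenvalues]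
    simp
  have hle : ∀ i ∈ Finset.univ, Real.log (hM.isHermitian.eigenvalues i) ≤
      hM.isHermitian.eigenvalues i - 1 := fun i _ => Real.log_le_sub_one_of_pos (hp i)
  rw [hd, ht]
  refine ⟨Finset.sum_le_sum hle, fun h => ?_⟩
  rw [Finset.sum_eq_sum_iff_of_le hle] at h
  have h1 : hM.isHermitian.eigenvalues = fun _ => 1 := by
    funext i
    by_contra hne
    exact (Real.log_lt_sub_one_of_pos (hp i) hne).ne (h i (Finset.mem_univ i))
  rw [hM.isHermitian.spectral_theorem, h1]
  have : diagonal ((RCLike.ofReal : ℝ → ℝ) ∘ fun _ : Fin n => (1:ℝ)) = 1 := by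
    ext i j; simp [Matrix.one_apply, diagonal_apply]
  rw [this, map_one]

lemma projV_trace {n : ℕ} (V : Finset (Fin n × Fin n)) (A X : Matrix (Fin n) (Fin n) ℝ)
    (hX : InSV V X) : (projV V A * X).trace = (A * X).trace := by
  simp only [Matrix.trace, Matrix.diag, Matrix.mul_apply]
  refine Finset.sum_congr rfl fun i _ => Finset.sum_congr rfl fun j _ => ?_
  by_cases h : i = j ∨ (i, j) ∈ V ∨ (j, i) ∈ V
  · simp [projV, h]
  · have h' := h
    push Not at h'
    rw [hX.2 j i (Ne.symm h'.1) h'.2.2 h'.2.1]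
    simp

open Matrix MatrixOrder Matrix.Norms.L2Operator in
lemma pd_ineq {n : ℕ} (Xh X : Matrix (Fin n) (Fin n) ℝ) (hh : Xh.PosDef) (hX : X.PosDef) :
    -(Xh⁻¹ * X).trace + Real.log X.det ≤ Real.log Xh.det - n ∧
      (-(Xh⁻¹ * X).trace + Real.log X.det = Real.log Xh.det - n ↔ X = Xh) := by
  obtain ⟨B, hB, hBX⟩ : ∃ B : Matrix (Fin n) (Fin n) ℝ, IsUnit B ∧ Xh⁻¹ = B * star B := by
    obtain ⟨B, hBe⟩ := CStarAlgebra.nonneg_iff_eq_mul_star_self.mp hh.inv.posSemidef.nonneg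
    refine ⟨B, ?_, hBe⟩
    rw [Matrix.isUnit_iff_isUnit_det, isUnit_iff_ne_zero]
    intro h0
    have h1 := hh.inv.det_pos
    rw [hBe, det_mul, h0, zero_mul] at h1
    exact lt_irrefl _ h1
  have hdB : B.det ≠ 0 := ((Matrix.isUnit_iff_isUnit_det B).1 hB).ne_zero
  have hM : (star B * X * B).PosDef := (Matrix.IsUnit.posDef_star_left_conjugate_iff hB).2 hX
  have htr : (star B * X * B).trace = (Xh⁻¹ * X).trace := by
    rw [hBX, Matrix.trace_mul_comm, Matrix.mul_assoc]
  have hdet : (star B * X * B).det = X.det / Xh.det := by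
    have : Xh.det⁻¹ = B.det * (star B).det := by
      rw [← det_mul, ← hBX, det_nonsing_inv, Ring.inverse_eq_inv']
    rw [det_mul, det_mul, div_eq_mul_inv, this]
    ring
  have hlog : Real.log (star B * X * B).det = Real.log X.det - Real.log Xh.det := by
    rw [hdet, Real.log_div hX.det_pos.ne' hh.det_pos.ne']
  obtain ⟨h1, h2⟩ := log_det_le_trace _ hM
  rw [hlog, htr] at h1 h2
  have hu : IsUnit Xh.det := hh.det_pos.ne'.isUnit
  refine ⟨by linarith, fun h => ?_, fun h => ?_⟩
  · have h3 := h2 (by linarith)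
    have h4 : Xh⁻¹ * X = 1 := by
      rw [hBX, Matrix.mul_assoc]
      rw [mul_eq_one_comm]
      exact h3
    calc X = Xh * (Xh⁻¹ * X) := by rw [Matrix.mul_nonsing_inv_cancel_left _ _ hu]
      _ = Xh := by rw [h4, Matrix.mul_one]
  · subst h
    rw [Matrix.nonsing_inv_mul _ hu]
    simp
    ring

/-- For positive definite `X̂ ∈ S^n_V` and `S = P(X̂⁻¹)`: every positive definite
`X ∈ S^n_V` satisfies `−tr(S X) + log det X ≤ log det X̂ − n`, with equality iff
`X = X̂`; consequently the supremum defining the conjugate barrier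
`f_*(S) = sup {−tr(SX) − f(X)}` is attained at `X̂` with value `log det X̂ − n`. -/
theorem stmt_18 (n : ℕ) (hn : 1 ≤ n) (V : Finset (Fin n × Fin n))
    (hV : IsPatternF V)
    (Xh : Matrix (Fin n) (Fin n) ℝ) (hXh : InSV V Xh) (hXhpd : Xh.PosDef)
    (S : Matrix (Fin n) (Fin n) ℝ) (hS : S = projV V Xh⁻¹) :
    (∀ X : Matrix (Fin n) (Fin n) ℝ, InSV V X → X.PosDef →
      -(S * X).trace + Real.log X.det ≤ Real.log Xh.det - n ∧
      (-(S * X).trace + Real.log X.det = Real.log Xh.det - n ↔ X = Xh)) ∧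
    IsGreatest
      {v : ℝ | ∃ X : Matrix (Fin n) (Fin n) ℝ,
        InSV V X ∧ X.PosDef ∧ v = -(S * X).trace + Real.log X.det}
      (Real.log Xh.det - n) := by
  subst hS
  have key : ∀ X : Matrix (Fin n) (Fin n) ℝ, InSV V X → X.PosDef →
      -(projV V Xh⁻¹ * X).trace + Real.log X.det ≤ Real.log Xh.det - n ∧
      (-(projV V Xh⁻¹ * X).trace + Real.log X.det = Real.log Xh.det - n ↔ X = Xh) := by
    intro X hX hXp
    rw [projV_trace V _ X hX]
    exact pd_ineq Xh X hXhpd hXp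
  refine ⟨key, ⟨Xh, hXh, hXhpd, ((key Xh hXh hXhpd).2.2 rfl).symm⟩, ?_⟩
  rintro v ⟨X, hX, hXp, rfl⟩
  exact (key X hX hXp).1
end

section
/- Let V be a filled sparsity pattern on {1,…,n} and let S ∈ S^n_V admit a positive definite completion (i.e., there exists a symmetric positive definite Z with P(Z) = S). Then there exists a unique positive definite matrix X ∈ S^n_V such that P(X⁻¹) = S; equivalently, S has a unique positive definite completion Z with Z⁻¹ ∈ S^n_V, namely Z = X⁻¹. -/
open scoped MatrixOrder Matrix.Norms.L2Operator in
lemma pd_factor {n : ℕ} {A : Matrix (Fin n) (Fin n) ℝ} (hA : A.PosDef) :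
    ∃ B : Matrix (Fin n) (Fin n) ℝ, A = B.conjTranspose * B ∧ IsUnit B := by
  obtain ⟨B, hB⟩ := CStarAlgebra.nonneg_iff_eq_star_mul_self.mp hA.posSemidef.nonneg
  rw [Matrix.star_eq_conjTranspose] at hB
  refine ⟨B, hB, ?_⟩
  have h := hA.isUnit
  rw [hB, Matrix.isUnit_iff_isUnit_det, Matrix.det_mul] at h
  rw [Matrix.isUnit_iff_isUnit_det]
  exact isUnit_of_mul_isUnit_right h

lemma uniq_aux {n : ℕ} (V : Finset (Fin n × Fin n)) (X Y : Matrix (Fin n) (Fin n) ℝ)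
    (hX : InSV V X) (hY : InSV V Y) (pX : X.PosDef) (pY : Y.PosDef)
    (h : projV V X⁻¹ = projV V Y⁻¹) : X = Y := by
  have hXu := (Matrix.isUnit_iff_isUnit_det X).mp pX.isUnit
  have hYu := (Matrix.isUnit_iff_isUnit_det Y).mp pY.isUnit
  have ht : Matrix.trace ((X - Y) * (Y⁻¹ - X⁻¹)) = 0 := by
    simp only [Matrix.trace, Matrix.diag, Matrix.mul_apply]
    refine Finset.sum_eq_zero fun i _ => Finset.sum_eq_zero fun j _ => ?_
    by_cases hij : j = i ∨ (j, i) ∈ V ∨ (i, j) ∈ V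
    · have := congrFun (congrFun h j) i
      simp only [projV, Matrix.of_apply, if_pos hij] at this
      simp [this]
    · push Not at hij
      have h1 := hX.2 i j (Ne.symm hij.1) hij.2.2 hij.2.1
      have h2 := hY.2 i j (Ne.symm hij.1) hij.2.2 hij.2.1
      simp [h1, h2]
  have hid : Y⁻¹ - X⁻¹ = X⁻¹ * (X - Y) * Y⁻¹ := by
    rw [mul_sub, sub_mul, Matrix.nonsing_inv_mul _ hXu, one_mul, mul_assoc,
      Matrix.mul_nonsing_inv _ hYu, mul_one]
  obtain ⟨B, hB, uB⟩ := pd_factor pX.inv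
  obtain ⟨C, hC, uC⟩ := pd_factor pY.inv
  have hD : (X - Y).conjTranspose = X - Y := by
    rw [Matrix.conjTranspose_sub, pX.isHermitian.eq, pY.isHermitian.eq]
  have ht2 : Matrix.trace ((B * (X - Y) * C.conjTranspose).conjTranspose *
      (B * (X - Y) * C.conjTranspose)) = 0 := by
    rw [← ht, hid, hB, hC, Matrix.conjTranspose_mul, Matrix.conjTranspose_mul, hD,
      Matrix.conjTranspose_conjTranspose]
    simp only [mul_assoc]
    rw [Matrix.trace_mul_comm]
    simp only [mul_assoc]
  rw [Matrix.trace_conjTranspose_mul_self_eq_zero_iff] at ht2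
  have uC' : IsUnit C.conjTranspose := by
    rw [← Matrix.star_eq_conjTranspose]; exact uC.star
  rw [uC'.mul_left_eq_zero, uB.mul_right_eq_zero] at ht2
  exact sub_eq_zero.mp ht2

/-- Solve `(Z u)_i = s_i` on an index set with `u` supported on that set. -/
lemma solve_aux {n : ℕ} (Z : Matrix (Fin n) (Fin n) ℝ) (hZ : Z.PosDef)
    (I : Finset (Fin n)) (s : Fin n → ℝ) :
    ∃ u : Fin n → ℝ, (∀ i, i ∉ I → u i = 0) ∧ ∀ i ∈ I, ∑ j, Z i j * u j = s i := by
  classical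
  let A : Matrix I I ℝ := Z.submatrix (fun i => i.1) (fun i => i.1)
  have hA : A.PosDef := hZ.submatrix Subtype.val_injective
  have hAu := (Matrix.isUnit_iff_isUnit_det A).mp hA.isUnit
  let w : I → ℝ := A⁻¹.mulVec (fun i => s i.1)
  have hw : A.mulVec w = fun i => s i.1 := by
    simp only [w, Matrix.mulVec_mulVec, Matrix.mul_nonsing_inv _ hAu, Matrix.one_mulVec]
  refine ⟨fun i => if h : i ∈ I then w ⟨i, h⟩ else 0, fun i hi => by simp [hi], fun i hi => ?_⟩
  have := congrFun hw ⟨i, hi⟩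
  simp only [Matrix.mulVec, dotProduct, A, Matrix.submatrix_apply] at this
  rw [← this, ← Finset.sum_subset (Finset.subset_univ I) (by
    intro x _ hx; simp [hx]), ← Finset.sum_attach I]
  refine Finset.sum_congr rfl fun x _ => ?_
  simp

lemma pd_symm {n : ℕ} {Z : Matrix (Fin n) (Fin n) ℝ} (h : Z.PosDef) (i j) : Z i j = Z j i := by
  simpa using (h.isHermitian.apply i j).symm

lemma pd_quad {n : ℕ} {Z : Matrix (Fin n) (Fin n) ℝ} (h : Z.PosDef) (x : Fin n → ℝ)
    (hx : x ≠ 0) : 0 < ∑ i, x i * ∑ j, Z i j * x j := by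
  simpa [dotProduct, Matrix.mulVec] using h.dotProduct_mulVec_pos hx

lemma pd_quad_nonneg {n : ℕ} {Z : Matrix (Fin n) (Fin n) ℝ} (h : Z.PosDef) (x : Fin n → ℝ) :
    0 ≤ ∑ i, x i * ∑ j, Z i j * x j := by
  simpa [dotProduct, Matrix.mulVec] using h.posSemidef.dotProduct_mulVec_nonneg x

/-- Bordered matrix. -/
def bord {n : ℕ} (a : ℝ) (z : Fin n → ℝ) (Z : Matrix (Fin n) (Fin n) ℝ) :
    Matrix (Fin (n+1)) (Fin (n+1)) ℝ :=
  fun i j => Fin.cases (motive := fun _ => ℝ) (Fin.cases (motive := fun _ => ℝ) a z j)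
    (fun i' => Fin.cases (motive := fun _ => ℝ) (z i') (fun j' => Z i' j') j) i

lemma bord_zz {n : ℕ} (a : ℝ) (z : Fin n → ℝ) (Z : Matrix (Fin n) (Fin n) ℝ) :
    bord a z Z 0 0 = a := rfl
lemma bord_zs {n : ℕ} (a : ℝ) (z : Fin n → ℝ) (Z : Matrix (Fin n) (Fin n) ℝ) (j : Fin n) :
    bord a z Z 0 j.succ = z j := rfl
lemma bord_sz {n : ℕ} (a : ℝ) (z : Fin n → ℝ) (Z : Matrix (Fin n) (Fin n) ℝ) (j : Fin n) :
    bord a z Z j.succ 0 = z j := rfl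
lemma bord_ss {n : ℕ} (a : ℝ) (z : Fin n → ℝ) (Z : Matrix (Fin n) (Fin n) ℝ) (i j : Fin n) :
    bord a z Z i.succ j.succ = Z i j := rfl

lemma bord_pd {n : ℕ} (a : ℝ) (z u : Fin n → ℝ) (Z : Matrix (Fin n) (Fin n) ℝ) (hZ : Z.PosDef)
    (hz : ∀ i, z i = ∑ j, Z i j * u j) (hd : 0 < a - ∑ i, u i * z i) :
    (bord a z Z).PosDef := by
  refine Matrix.PosDef.of_dotProduct_mulVec_pos ?_ ?_
  · ext i j
    simp only [Matrix.conjTranspose_apply, star_trivial]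
    refine Fin.cases ?_ (fun i => ?_) i <;> refine Fin.cases ?_ (fun j => ?_) j
    · rfl
    · rfl
    · rfl
    · exact pd_symm hZ j i
  · intro x hx
    have hux : ∑ i, u i * ∑ j, Z i j * x j.succ = ∑ i, x i.succ * z i := by
      simp only [hz, Finset.mul_sum]
      rw [Finset.sum_comm]
      refine Finset.sum_congr rfl fun i _ => Finset.sum_congr rfl fun j _ => ?_
      rw [pd_symm hZ j i]; ring
    have key : star x ⬝ᵥ (bord a z Z).mulVec x = (a - ∑ i, u i * z i) * x 0 ^ 2 +
        ∑ i, (x i.succ + x 0 * u i) * ∑ j, Z i j * (x j.succ + x 0 * u j) := by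
      have e1 : ∀ i, ∑ j, Z i j * (x j.succ + x 0 * u j)
          = ∑ j, Z i j * x j.succ + x 0 * z i := by
        intro i
        rw [hz, Finset.mul_sum, ← Finset.sum_add_distrib]
        exact Finset.sum_congr rfl fun j _ => by ring
      have e2 : ∑ i, (x i.succ + x 0 * u i) * (∑ j, Z i j * x j.succ + x 0 * z i)
          = ∑ i, x i.succ * ∑ j, Z i j * x j.succ + x 0 * ∑ i, x i.succ * z i
            + x 0 * ∑ i, u i * ∑ j, Z i j * x j.succ + x 0 ^ 2 * ∑ i, u i * z i := by
        rw [Finset.mul_sum, Finset.mul_sum, Finset.mul_sum, ← Finset.sum_add_distrib,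
          ← Finset.sum_add_distrib, ← Finset.sum_add_distrib]
        exact Finset.sum_congr rfl fun j _ => by ring
      have e3 : ∑ i, x i.succ * (z i * x 0 + ∑ j, Z i j * x j.succ)
          = x 0 * ∑ i, x i.succ * z i + ∑ i, x i.succ * ∑ j, Z i j * x j.succ := by
        rw [Finset.mul_sum, ← Finset.sum_add_distrib]
        exact Finset.sum_congr rfl fun j _ => by ring
      have e4 : ∑ j, z j * x j.succ = ∑ i, x i.succ * z i :=
        Finset.sum_congr rfl fun j _ => by ring
      simp only [e1]
      rw [e2, hux]
      simp only [dotProduct, Matrix.mulVec, Fin.sum_univ_succ, bord_zz, bord_zs, bord_sz, bord_ss,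
        Pi.star_apply, star_trivial]
      rw [e3, e4]
      ring
    rw [key]
    by_cases h0 : x 0 = 0
    · have hne : (fun i : Fin n => x i.succ + x 0 * u i) ≠ 0 := by
        intro hh
        apply hx
        funext i
        refine Fin.cases h0 (fun i => ?_) i
        simpa [h0] using congrFun hh i
      have := pd_quad hZ _ hne
      have := mul_nonneg hd.le (sq_nonneg (x 0))
      linarith
    · have := pd_quad_nonneg hZ (fun i : Fin n => x i.succ + x 0 * u i)
      have : 0 < x 0 ^ 2 := by positivity
      have := mul_pos hd this
      linarith

lemma bord_inv {n : ℕ} (a d : ℝ) (z u : Fin n → ℝ) (X Z : Matrix (Fin n) (Fin n) ℝ)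
    (hZ : Z.PosDef) (hXZ : X * Z = 1)
    (hz : ∀ i, z i = ∑ j, Z i j * u j) (hd : d = a - ∑ i, u i * z i) (hd0 : d ≠ 0) :
    bord (1/d) (fun i => - u i / d) (Matrix.of fun i j => X i j + u i * u j / d) * bord a z Z = 1 := by
  have hXz : ∀ i, ∑ j, X i j * z j = u i := by
    intro i
    have hzz : z = Z.mulVec u := funext hz
    have : X.mulVec z = u := by rw [hzz, Matrix.mulVec_mulVec, hXZ, Matrix.one_mulVec]
    exact congrFun this i
  have huZ : ∀ j, ∑ i, u i * Z i j = z j := by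
    intro j
    rw [hz]
    exact Finset.sum_congr rfl fun i _ => by rw [pd_symm hZ i j]; ring
  have huz : ∑ i, u i * z i = a - d := by linarith
  ext i j
  rw [Matrix.mul_apply, Fin.sum_univ_succ]
  refine Fin.cases ?_ (fun i => ?_) i <;> refine Fin.cases ?_ (fun j => ?_) j
  · simp only [bord_zz, bord_zs, bord_sz, bord_ss, Matrix.of_apply, Matrix.one_apply_eq]
    have : ∑ x, -u x / d * z x = - (∑ i, u i * z i) / d := by
      rw [← Finset.sum_neg_distrib, Finset.sum_div]
      exact Finset.sum_congr rfl fun j _ => by ring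
    rw [this, huz]; field_simp; ring
  · simp only [bord_zz, bord_zs, bord_sz, bord_ss, Matrix.of_apply]
    have : ∑ x, -u x / d * Z x j = - (∑ i, u i * Z i j) / d := by
      rw [← Finset.sum_neg_distrib, Finset.sum_div]
      exact Finset.sum_congr rfl fun j _ => by ring
    rw [this, huZ, Matrix.one_apply_ne (Fin.succ_ne_zero j).symm]; ring
  · simp only [bord_zz, bord_zs, bord_sz, bord_ss, Matrix.of_apply]
    have : ∑ x, (X i x + u i * u x / d) * z x
        = ∑ x, X i x * z x + u i / d * ∑ x, u x * z x := by
      rw [Finset.mul_sum, ← Finset.sum_add_distrib]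
      exact Finset.sum_congr rfl fun j _ => by ring
    rw [this, huz, hXz, Matrix.one_apply_ne (Fin.succ_ne_zero i)]; field_simp; ring
  · simp only [bord_zz, bord_zs, bord_sz, bord_ss, Matrix.of_apply]
    have : ∑ x, (X i x + u i * u x / d) * Z x j
        = ∑ x, X i x * Z x j + u i / d * ∑ x, u x * Z x j := by
      rw [Finset.mul_sum, ← Finset.sum_add_distrib]
      exact Finset.sum_congr rfl fun j _ => by ring
    rw [this, huZ, ← Matrix.mul_apply, hXZ]
    simp only [Matrix.one_apply, Fin.succ_inj]
    ring

lemma exists_aux : ∀ (n : ℕ) (V : Finset (Fin n × Fin n)), IsFilledF V → IsPatternF V →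
    ∀ Z0 : Matrix (Fin n) (Fin n) ℝ, Z0.PosDef →
    ∃ X Z : Matrix (Fin n) (Fin n) ℝ, Z.PosDef ∧ X * Z = 1 ∧
      (∀ i j, i = j ∨ (i, j) ∈ V ∨ (j, i) ∈ V → Z i j = Z0 i j) ∧
      (∀ i j, i ≠ j → (i, j) ∉ V → (j, i) ∉ V → X i j = 0) := by
  intro n
  induction n with
  | zero =>
    intro V _ _ Z0 hZ0
    exact ⟨1, Z0, hZ0, Subsingleton.elim _ _, fun _ _ _ => rfl, fun i => i.elim0⟩
  | succ n ih =>
    intro V hF hP Z0 hZ0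
    let V' : Finset (Fin n × Fin n) := Finset.univ.filter fun p => (p.1.succ, p.2.succ) ∈ V
    have hV' : ∀ i j, (i, j) ∈ V' ↔ (i.succ, j.succ) ∈ V := by simp [V']
    obtain ⟨X, Z, hZ, hXZ, hag, hsp⟩ := ih V'
      (by
        intro i j k h1 h2 h3 h4
        rw [hV'] at *
        exact hF _ _ _ (Fin.succ_lt_succ_iff.mpr h1) (Fin.succ_lt_succ_iff.mpr h2) h3 h4)
      (by
        rintro ⟨i, j⟩ hp
        rw [hV'] at hp
        exact Fin.succ_lt_succ_iff.mp (hP _ hp))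
      (Z0.submatrix Fin.succ Fin.succ) (hZ0.submatrix (Fin.succ_injective n))
    simp only [hV', Matrix.submatrix_apply] at hag hsp
    let I : Finset (Fin n) := Finset.univ.filter fun i => (i.succ, 0) ∈ V
    have hI : ∀ i, i ∈ I ↔ (i.succ, 0) ∈ V := by simp [I]
    have hcl : ∀ i ∈ I, ∀ j ∈ I, i = j ∨ (i.succ, j.succ) ∈ V ∨ (j.succ, i.succ) ∈ V := by
      intro i hi j hj
      rw [hI] at hi hj
      rcases lt_trichotomy i j with h | h | h
      · exact .inr (.inr (hF _ _ _ (Fin.succ_pos i) (Fin.succ_lt_succ_iff.mpr h) hj hi))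
      · exact .inl h
      · exact .inr (.inl (hF _ _ _ (Fin.succ_pos j) (Fin.succ_lt_succ_iff.mpr h) hi hj))
    obtain ⟨u, hu0, hu⟩ := solve_aux Z hZ I (fun i => Z0 i.succ 0)
    let z : Fin n → ℝ := fun i => ∑ j, Z i j * u j
    have hd : 0 < Z0 0 0 - ∑ i, u i * z i := by
      have hx : (Fin.cases (motive := fun _ => ℝ) 1 (fun i => - u i) : Fin (n+1) → ℝ) ≠ 0 := by
        intro h
        have := congrFun h 0
        simp at this
      have h := pd_quad hZ0 _ hx
      simp only [Fin.sum_univ_succ, Fin.cases_zero, Fin.cases_succ] at h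
      have e1 : ∑ i, u i * z i = ∑ i : Fin n, Z0 0 i.succ * u i := by
        refine Finset.sum_congr rfl fun i _ => ?_
        by_cases hi : i ∈ I
        · rw [pd_symm hZ0 0, ← hu i hi]; simp only [z]; ring
        · simp [hu0 i hi]
      have e2 : ∀ i : Fin n, - u i * (Z0 i.succ 0 * 1 + ∑ j : Fin n, Z0 i.succ j.succ * - u j)
          = 0 := by
        intro i
        by_cases hi : i ∈ I
        · have : ∑ j : Fin n, Z0 i.succ j.succ * - u j = - z i := by
            simp only [z]
            rw [← Finset.sum_neg_distrib]
            refine Finset.sum_congr rfl fun j _ => ?_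
            by_cases hj : j ∈ I
            · rw [hag i j (hcl i hi j hj)]; ring
            · simp [hu0 j hj]
          rw [this, ← hu i hi]; simp only [z]; ring
        · simp [hu0 i hi]
      simp only [e2] at h
      rw [e1]
      simp only [mul_neg, Finset.sum_neg_distrib, Finset.sum_const_zero] at h
      linarith
    refine ⟨_, bord (Z0 0 0) z Z, bord_pd _ z u Z hZ (fun _ => rfl) hd,
      bord_inv _ _ z u X Z hZ hXZ (fun _ => rfl) rfl hd.ne', ?_, ?_⟩
    · have hzI : ∀ i : Fin n, (i.succ, 0) ∈ V → z i = Z0 i.succ 0 :=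
        fun i hi => hu i ((hI i).mpr hi)
      have hno : ∀ i : Fin n, (0, i.succ) ∉ V := fun i hi =>
        absurd (hP _ hi) (Fin.not_lt_zero _)
      intro i j
      refine Fin.cases ?_ (fun i => ?_) i <;> refine Fin.cases ?_ (fun j => ?_) j
      · intro _; rfl
      · rintro (h | h | h)
        · exact absurd h.symm (Fin.succ_ne_zero j)
        · exact absurd h (hno j)
        · rw [bord_zs, hzI j h, pd_symm hZ0]
      · rintro (h | h | h)
        · exact absurd h (Fin.succ_ne_zero i)
        · rw [bord_sz, hzI i h]
        · exact absurd h (hno i)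
      · intro h
        rw [bord_ss]
        exact hag i j (by simpa using h)
    · intro i j
      refine Fin.cases ?_ (fun i => ?_) i <;> refine Fin.cases ?_ (fun j => ?_) j
      · intro h; exact absurd rfl h
      · intro _ _ h
        rw [bord_zs, hu0 j (by rwa [hI])]; simp
      · intro _ h _
        rw [bord_sz, hu0 i (by rwa [hI])]; simp
      · intro h1 h2 h3
        rw [bord_ss, Matrix.of_apply, hsp i j (by simpa using h1) h2 h3]
        by_cases hi : i ∈ I
        · by_cases hj : j ∈ I
          · rcases hcl i hi j hj with h | h | h
            · exact absurd (congrArg Fin.succ h) h1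
            · exact absurd h h2
            · exact absurd h h3
          · simp [hu0 j hj]
        · simp [hu0 i hi]

/-- If `V` is filled and `S ∈ S^n_V` has a positive definite completion, then there is a
unique positive definite `X ∈ S^n_V` with `P(X⁻¹) = S`; equivalently, `S` has a unique
positive definite completion `Z` with `Z⁻¹ ∈ S^n_V` (namely `Z = X⁻¹`). -/
theorem stmt_19 (n : ℕ) (hn : 1 ≤ n) (V : Finset (Fin n × Fin n))
    (hV : IsPatternF V) (hF : IsFilledF V)
    (S : Matrix (Fin n) (Fin n) ℝ) (hS : InSV V S)
    (hcompl : ∃ Z : Matrix (Fin n) (Fin n) ℝ, Z.PosDef ∧ projV V Z = S) :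
    (∃! X : Matrix (Fin n) (Fin n) ℝ,
      InSV V X ∧ X.PosDef ∧ projV V X⁻¹ = S) ∧
    (∃! Z : Matrix (Fin n) (Fin n) ℝ,
      Z.PosDef ∧ projV V Z = S ∧ InSV V Z⁻¹) := by
  obtain ⟨Z0, hZ0, hZS⟩ := hcompl
  obtain ⟨X, Z, hZ, hXZ, hag, hsp⟩ := exists_aux n V hF hV Z0 hZ0
  have hXe : Z⁻¹ = X := Matrix.inv_eq_left_inv hXZ
  have hZe : X⁻¹ = Z := Matrix.inv_eq_right_inv hXZ
  have hXp : X.PosDef := hXe ▸ hZ.inv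
  have hXS : InSV V X := by
    refine ⟨?_, hsp⟩
    ext i j
    exact pd_symm hXp j i
  have hPZ : projV V Z = S := by
    rw [← hZS]
    ext i j
    simp only [projV, Matrix.of_apply]
    split_ifs with h
    · exact hag i j h
    · rfl
  refine ⟨⟨X, ⟨hXS, hXp, by rw [hZe, hPZ]⟩, ?_⟩, ⟨Z, ⟨hZ, hPZ, by rwa [hXe]⟩, ?_⟩⟩
  · rintro Y ⟨h1, h2, h3⟩
    exact uniq_aux V Y X h1 hXS h2 hXp (by rw [h3, hZe, hPZ])
  · rintro W ⟨h1, h2, h3⟩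
    have hWW : W⁻¹⁻¹ = W :=
      Matrix.nonsing_inv_nonsing_inv _ ((Matrix.isUnit_iff_isUnit_det W).mp h1.isUnit)
    have := uniq_aux V W⁻¹ X h3 hXS h1.inv hXp (by rw [hWW, hZe, h2, hPZ])
    rw [← hWW, this, hZe]
end
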